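/- The operator N̂ measures the Euler characteristic: for all integers g ≥ 0 and B ≥ 1 with 2g+B−2 > 0 (so B ≥ 3 if g = 0), N̂G_g(z₁|…|z_B) = (2g+B−2)·G_g(z₁|…|z_B), where N̂ acts on the ϱ-dependence of the multi-boundary function. -/

import Mathlib

open scoped BigOperators
open MeasureTheory

noncomputable section

namespace NCQFT

/-! ### Measure data: the planar 1‑point function `G0fun`, the moments and the operator `K̂`. -/

/-- The planar one-point function `𝒢₀(z) = s·z − n̄ + ½∫ᵃᵇ r(y)/((z+y)y) dy`. -/
def G0fun (a b s nbar : ℝ) (r : ℝ → ℝ) (z : ℂ) : ℂ :=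
  (s : ℂ) * z - (nbar : ℂ) + (1 / 2) * ∫ y in a..b, (r y : ℂ) / ((z + (y : ℂ)) * (y : ℂ))

/-- Moments `ϱ_l = s·δ_{l,0} − ½∫ᵃᵇ r(y)/y^{3+2l} dy` of the measure. -/
def moment (a b s : ℝ) (r : ℝ → ℝ) (l : ℕ) : ℝ :=
  (if l = 0 then s else 0) - (1 / 2) * ∫ y in a..b, r y / y ^ (3 + 2 * l)

/-- The integral operator `K̂`. -/
def Khat (a b s nbar : ℝ) (r : ℝ → ℝ) (f : ℂ → ℂ) (z : ℂ) : ℂ :=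
  G0fun a b s nbar r z * f z + (nbar : ℂ) * f z
    + (1 / 2) * ∫ y in a..b, (r y : ℂ) * (f z - f (y : ℂ)) / (z ^ 2 - (y : ℂ) ^ 2)

/-- Admissible points: `z ∉ [a,b] ∪ (−[a,b]) ∪ {0}`. -/
def Admissible (a b : ℝ) (z : ℂ) : Prop :=
  z ≠ 0 ∧ ∀ y : ℝ, y ∈ Set.Icc a b → z ≠ (y : ℂ) ∧ z ≠ -(y : ℂ)

/-! ### Partial Bell polynomials and the polynomials `S_m(ϱ)`. -/

/-- Partial Bell polynomial `B_{n,k}(x₁,…,x_{n−k+1})`. -/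
def bellP (n k : ℕ) (x : ℕ → ℝ) : ℝ :=
  ∑ j : Fin n → Fin (n + 1),
    if (∑ i : Fin n, (j i : ℕ)) = k ∧ (∑ i : Fin n, ((i : ℕ) + 1) * (j i : ℕ)) = n then
      (n.factorial : ℝ) / (∏ i : Fin n, ((j i : ℕ).factorial : ℝ)) *
        ∏ i : Fin n, (x ((i : ℕ) + 1) / (((i : ℕ) + 1).factorial : ℝ)) ^ (j i : ℕ)
    else 0

/-- `S_m(ϱ) = Σ_{i=0}^m (−1)^i i! ϱ₀^{−i} B_{m,i}(1!ϱ₁,…,(m−i+1)!ϱ_{m−i+1})`. -/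
def Sm (ρ : ℕ → ℝ) (m : ℕ) : ℝ :=
  ∑ i ∈ Finset.range (m + 1),
    (-1) ^ i * (i.factorial : ℝ) * ((ρ 0)⁻¹) ^ i *
      bellP m i (fun j => (j.factorial : ℝ) * ρ j)

/-! ### Partial derivatives in the moment variables. -/

/-- Partial derivative `∂/∂ϱ_l` of a real-valued function of the moments. -/
def pdR (c : (ℕ → ℝ) → ℝ) (l : ℕ) (ρ : ℕ → ℝ) : ℝ :=
  deriv (fun t => c (Function.update ρ l t)) (ρ l)

/-- Partial derivative `∂/∂ϱ_l` of a complex-valued function of the moments. -/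
def pdC (c : (ℕ → ℝ) → ℂ) (l : ℕ) (ρ : ℕ → ℝ) : ℂ :=
  deriv (fun t : ℝ => c (Function.update ρ l t)) (ρ l)

/-! ### Boundary creation operators. -/

/-- Boundary creation operator `Â†_{z_J,w}` with free creation variable `w`, acting on a
family `F` of the moments `ϱ` and boundary variables `(z_i)_{i∈J}`. -/
def AdagFree (J : Finset ℕ) (F : (ℕ → ℝ) → (ℕ → ℂ) → ℂ)
    (ρ : ℕ → ℝ) (z : ℕ → ℂ) (w : ℂ) : ℂ :=
  (∑' l : ℕ, (-((3 + 2 * (l : ℂ)) * (ρ (l + 1) : ℂ)) / ((ρ 0 : ℂ) * w ^ 3)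
      + (3 + 2 * (l : ℂ)) / w ^ (5 + 2 * l)) * pdC (fun σ => F σ z) l ρ)
  + ∑ i ∈ J, (1 / ((ρ 0 : ℂ) * w ^ 3 * z i)) *
      deriv (fun v => F ρ (Function.update z i v)) (z i)

/-- Boundary creation operator creating a boundary at coordinate `p`. -/
def AdagVar (J : Finset ℕ) (p : ℕ) (F : (ℕ → ℝ) → (ℕ → ℂ) → ℂ) :
    (ℕ → ℝ) → (ℕ → ℂ) → ℂ :=
  fun ρ z => AdagFree J F ρ z (z p)

/-- Boundary creation operator `Â†_w` acting on scalar functions of the moments only. -/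
def AdagScalar (F : (ℕ → ℝ) → ℝ) (ρ : ℕ → ℝ) (w : ℂ) : ℂ :=
  ∑' l : ℕ, (-((3 + 2 * (l : ℂ)) * (ρ (l + 1) : ℂ)) / ((ρ 0 : ℂ) * w ^ 3)
      + (3 + 2 * (l : ℂ)) / w ^ (5 + 2 * l)) * (pdR F l ρ : ℂ)

/-! ### The genus recursion for the 1-boundary functions `𝒢_g(z) = Σ_k c_{g,k}(ϱ)/z^{2k+3}`. -/

/-- Coefficients `e_m(ϱ)` of the even bracket
`w²·(Σ_{h=1}^{g-1} G_h(w)G_{g−h}(w) + (2λ)²·G_{g−1}(w|w))`, expressed through the table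
`prev` of the coefficients of the lower-genus one-boundary functions. -/
def eBr (lam : ℝ) (g : ℕ) (prev : ℕ → ℕ → (ℕ → ℝ) → ℝ) (m : ℕ) (ρ : ℕ → ℝ) : ℝ :=
  (∑ h ∈ Finset.Icc 1 (g - 1), ∑ i ∈ Finset.range (m + 1), ∑ j ∈ Finset.range (m + 1),
      if i + j + 2 = m then prev h i ρ * prev (g - h) j ρ else 0)
  + (2 * lam) ^ 4 *
    ((if 2 ≤ m then
        -(1 / ρ 0) * ∑' l : ℕ, (3 + 2 * (l : ℝ)) * ρ (l + 1) * pdR (prev (g - 1) (m - 2)) l ρ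
      else 0)
    + (∑ k ∈ Finset.range (m + 1), ∑ l ∈ Finset.range (m + 1),
        if k + l + 3 = m then (3 + 2 * (l : ℝ)) * pdR (prev (g - 1) k) l ρ else 0)
    + (if 3 ≤ m then -(((2 * (m - 3) + 3 : ℕ) : ℝ) * prev (g - 1) (m - 3) ρ) / ρ 0 else 0))

/-- Table of the coefficients of the one-boundary functions for all genera `h ≤ G`.
`Gtab lam G h k ρ` is the coefficient of `z^{-(2k+3)}` in `𝒢_h(z)`. -/
def Gtab (lam : ℝ) : ℕ → ℕ → ℕ → (ℕ → ℝ) → ℝ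
  | 0 => fun _ _ _ => 0
  | 1 => fun h k ρ =>
      if h = 1 then
        (if k = 0 then 2 * lam ^ 4 * ρ 1 / (ρ 0) ^ 2
         else if k = 1 then -(2 * lam ^ 4) / ρ 0 else 0)
      else 0
  | (G + 2) => fun h k ρ =>
      if h ≤ G + 1 then Gtab lam (G + 1) h k ρ
      else if h = G + 2 then
        -(1 / (2 * ρ 0)) *
          ∑' j : ℕ, eBr lam (G + 2) (Gtab lam (G + 1)) (k + j) ρ * Sm ρ j / (j.factorial : ℝ)
      else 0

/-- Coefficients of the genus-`g` one-boundary function. -/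
def Gcoef (lam : ℝ) (g : ℕ) : ℕ → (ℕ → ℝ) → ℝ := Gtab lam g g

/-- One-boundary function `𝒢_g(z)` of genus `g ≥ 1`. -/
def Gfun (lam : ℝ) (g : ℕ) (ρ : ℕ → ℝ) (z : ℂ) : ℂ :=
  ∑' k : ℕ, (Gcoef lam g k ρ : ℂ) / z ^ (2 * k + 3)

/-- The same-point two-boundary function `𝒢_g(z|z)`, with
`𝒢₀(z|z) := λ²/z⁴` and `𝒢_g(z|z) := (2λ)²(Â†_z + (1/(ϱ₀z⁴))∂_z)𝒢_g(z)` for `g ≥ 1`. -/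
def Gpair (lam : ℝ) (g : ℕ) (ρ : ℕ → ℝ) (z : ℂ) : ℂ :=
  if g = 0 then (lam : ℂ) ^ 2 / z ^ 4
  else (2 * (lam : ℂ)) ^ 2 *
    ((∑' l : ℕ, (-((3 + 2 * (l : ℂ)) * (ρ (l + 1) : ℂ)) / ((ρ 0 : ℂ) * z ^ 3)
        + (3 + 2 * (l : ℂ)) / z ^ (5 + 2 * l)) * pdC (fun σ => Gfun lam g σ z) l ρ)
     + (1 / ((ρ 0 : ℂ) * z ^ 4)) * deriv (Gfun lam g ρ) z)

/-! ### Multi-boundary functions. -/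

/-- Iterated boundary creation for `g ≥ 1` (without prefactors); coordinates `0,…,B−1`. -/
def GBraw (lam : ℝ) (g : ℕ) : ℕ → (ℕ → ℝ) → (ℕ → ℂ) → ℂ
  | 0 => fun _ _ => 0
  | 1 => fun ρ z => Gfun lam g ρ (z 0)
  | (B + 2) => AdagVar (Finset.range (B + 1)) (B + 1) (GBraw lam g (B + 1))

/-- Iterated boundary creation for `g = 0` (without prefactors), starting from `𝒢₀(z₁|z₂)`. -/
def GBraw0 (lam : ℝ) : ℕ → (ℕ → ℝ) → (ℕ → ℂ) → ℂ
  | 0 => fun _ _ => 0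
  | 1 => fun _ _ => 0
  | 2 => fun _ z => 4 * (lam : ℂ) ^ 2 / (z 0 * z 1 * (z 0 + z 1) ^ 2)
  | (B + 3) => AdagVar (Finset.range (B + 2)) (B + 2) (GBraw0 lam (B + 2))

/-- The multi-boundary functions `𝒢_g(z₁|…|z_B)`, with variables at coordinates `0,…,B−1`:
`𝒢_g(z₁|…|z_B) = (2λ)^{3B−4} Â†_{(z₁..z_{B−1}),z_B}(⋯ Â†_{(z₁),z₂}𝒢_g(z₁)⋯)` for `g ≥ 1`,
and `𝒢₀(z₁|…|z_B) = (2λ)^{3B−6} Â†(⋯ Â†𝒢₀(z₁|z₂)⋯)` for `g = 0`. -/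
def GBfun (lam : ℝ) (g B : ℕ) (ρ : ℕ → ℝ) (z : ℕ → ℂ) : ℂ :=
  if g = 0 then (2 * (lam : ℂ)) ^ (3 * B - 6) * GBraw0 lam B ρ z
  else if B = 1 then Gfun lam g ρ (z 0)
  else (2 * (lam : ℂ)) ^ (3 * B - 4) * GBraw lam g B ρ z

/-! ### Free energies and boundary annihilation. -/

/-- Boundary annihilation applied to `𝒢_g`:  `Â_ǎ 𝒢_g = −Σ_l ϱ_l/(3+2l) · c_{g,l+1}(ϱ)`
(the coefficient of `z^{−5−2l}` in `𝒢_g(z)` is `c_{g,l+1}`). -/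
def AcheckG (lam : ℝ) (g : ℕ) (ρ : ℕ → ℝ) : ℝ :=
  -∑' l : ℕ, ρ l / (3 + 2 * (l : ℝ)) * Gcoef lam g (l + 1) ρ

/-- Free energies: `F₁ = −(1/24)·log ϱ₀`, and
`F_g = (1/((2g−2)(2λ)⁴))·Â_ǎ(𝒢_g)` for `g ≥ 2`. -/
def Ffree (lam : ℝ) (g : ℕ) (ρ : ℕ → ℝ) : ℝ :=
  if g = 1 then -(1 / 24) * Real.log (ρ 0)
  else 1 / ((2 * (g : ℝ) - 2) * (2 * lam) ^ 4) * AcheckG lam g ρ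

/-! ### Auxiliary notions. -/

/-- Variable assignment `(z₁, z_{i₁}, z_{i₂}, …)` with first slot `w` and the remaining slots
filled by the coordinates of `z` indexed by the set `I` in increasing order. -/
def slotAt (z : ℕ → ℂ) (w : ℂ) (I : Finset ℕ) : ℕ → ℂ :=
  fun n => if n = 0 then w else z ((I.sort (· ≤ ·)).getD (n - 1) 0)

/-- A polynomial in variables `x₁,…,x_j` is `j`-weighted if each of its monomials
`∏ x_i^{m_i}` satisfies `Σ i·m_i = j`. -/
def IsWeighted (j : ℕ) (P : MvPolynomial (Fin j) ℚ) : Prop :=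
  ∀ m ∈ P.support, (∑ i : Fin j, ((i : ℕ) + 1) * m i) = j

/-- A smooth family `F(ϱ₀,…,ϱ_M; (z_i)_{i∈J})`: it factors through a function of the first
`M+1` moments and the coordinates in `J` which is smooth (and holomorphic in each `z_i`)
on the region `ϱ₀ ≠ 0`, `z_i ≠ 0`. -/
def SmoothFam (M : ℕ) (J : Finset ℕ) (F : (ℕ → ℝ) → (ℕ → ℂ) → ℂ) : Prop :=
  ∃ Ft : ((Fin (M + 1) → ℝ) × ({ i // i ∈ J } → ℂ)) → ℂ,
    ContDiffOn ℝ (⊤ : ℕ∞) Ft { x | x.1 0 ≠ 0 ∧ ∀ i, x.2 i ≠ 0 } ∧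
    (∀ x ∈ ({ x : (Fin (M + 1) → ℝ) × ({ i // i ∈ J } → ℂ) |
        x.1 0 ≠ 0 ∧ ∀ i, x.2 i ≠ 0 }), ∀ i,
      DifferentiableAt ℂ (fun w => Ft (x.1, Function.update x.2 i w)) (x.2 i)) ∧
    ∀ ρ z, F ρ z = Ft (fun l => ρ (l : ℕ), fun i => z (i : ℕ))

/-- A smooth scalar function of `ϱ₀ ≠ 0, ϱ₁, …, ϱ_M`. -/
def SmoothScalarFam (M : ℕ) (F : (ℕ → ℝ) → ℝ) : Prop :=
  ∃ Ft : (Fin (M + 1) → ℝ) → ℝ,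
    ContDiffOn ℝ (⊤ : ℕ∞) Ft { v | v 0 ≠ 0 } ∧ ∀ ρ : ℕ → ℝ, F ρ = Ft (fun l => ρ (l : ℕ))

/-! ### The Laplacian of Theorem `Δ_ϱ`. -/

/-- `R_m(ϱ) = −(2/3) Σ_{k=1}^m (kϱ_k/((3+2k)ϱ₀))·S_{m−k}(ϱ)/(m−k)!`. -/
def Rm (ρ : ℕ → ℝ) (m : ℕ) : ℝ :=
  -(2 / 3) * ∑ k ∈ Finset.Icc 1 m,
    ((k : ℝ) * ρ k / ((3 + 2 * (k : ℝ)) * ρ 0)) * (Sm ρ (m - k) / ((m - k).factorial : ℝ))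

/-- The Laplacian `Δ_ϱ`, acting on functions of the moments. -/
def DeltaRho (F : (ℕ → ℝ) → ℝ) (ρ : ℕ → ℝ) : ℝ :=
  -(-(6 * ρ 1 ^ 3) / (5 * ρ 0 ^ 3) + 111 * ρ 1 * ρ 2 / (70 * ρ 0 ^ 2)
      - ρ 3 / (2 * ρ 0)) * pdR (fun σ => pdR F 0 σ) 0 ρ
  - (2 * ρ 1 ^ 3 / ρ 0 ^ 4 - 1097 * ρ 1 * ρ 2 / (280 * ρ 0 ^ 3)
      + 41 * ρ 3 / (24 * ρ 0 ^ 2)) * pdR F 0 ρ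
  - (∑' k : ℕ, (3 + 2 * ((k : ℝ) + 1)) *
      ((-(2 * ρ 1 ^ 2 / (5 * ρ 0 ^ 3)) + 2 * ρ 2 / (7 * ρ 0 ^ 2)) * ρ (k + 2)
        - 3 * Rm ρ (k + 3) * ρ 1 / (2 * ρ 0) + 3 * Rm ρ (k + 4) / 2) *
      pdR (fun σ => pdR F 0 σ) (k + 1) ρ)
  - (∑' k : ℕ, ∑' l : ℕ, (3 + 2 * ((k : ℝ) + 1)) * (3 + 2 * ((l : ℝ) + 1)) *
      (-(ρ 1 * ρ (l + 2) * ρ (k + 2) / (30 * ρ 0 ^ 2))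
        - ρ (k + 2) * Rm ρ (l + 3) / (4 * ρ 0)
        - ρ (l + 2) * Rm ρ (k + 3) / (4 * ρ 0)
        + Rm ρ (k + l + 5) / 4) *
      pdR (fun σ => pdR F (l + 1) σ) (k + 1) ρ)
  - (∑' k : ℕ, (3 + 2 * ((k : ℝ) + 1)) *
      ((19 * ρ 1 ^ 2 / (60 * ρ 0 ^ 4) - 25 * ρ 2 / (84 * ρ 0 ^ 3)) * ρ (k + 2)
        + ρ 1 * Rm ρ (k + 3) / (16 * ρ 0 ^ 2)
        - Rm ρ (k + 4) / (16 * ρ 0)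
        - (5 + 2 * ((k : ℝ) + 1)) * ρ 1 * ρ (k + 3) / (30 * ρ 0 ^ 3)
        - (5 + 2 * ((k : ℝ) + 1)) * Rm ρ (k + 4) / (2 * ρ 0)) *
      pdR F (k + 1) ρ)

/-- The operator `D = −(2λ)⁴Δ_ϱ + (2λ)⁴·(−21ϱ₁³/(160ϱ₀⁵)+29ϱ₁ϱ₂/(128ϱ₀⁴)−35ϱ₃/(384ϱ₀³))·`. -/
def Dop (lam : ℝ) (F : (ℕ → ℝ) → ℝ) : (ℕ → ℝ) → ℝ :=
  fun ρ => -(2 * lam) ^ 4 * DeltaRho F ρ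
    + (2 * lam) ^ 4 * (-(21 / 160) * ρ 1 ^ 3 / ρ 0 ^ 5 + (29 / 128) * ρ 1 * ρ 2 / ρ 0 ^ 4
        - (35 / 384) * ρ 3 / ρ 0 ^ 3) * F ρ

end NCQFT

namespace NCQFT

/-- The domain on which the `B`-boundary functions are regular. -/
def Dom (B : ℕ) (ρ : ℕ → ℝ) (z : ℕ → ℂ) : Prop :=
  ρ 0 ≠ 0 ∧ (∀ i, i < B → z i ≠ 0) ∧ ∀ i j, i < B → j < B → i ≠ j → z i + z j ≠ 0

/-- Rational functions, homogeneous of degree `-d` in the moments. -/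
inductive Nice (B : ℕ) : ℤ → ((ℕ → ℝ) → (ℕ → ℂ) → ℂ) → Prop
  | zero (d : ℤ) : Nice B d (fun _ _ => 0)
  | const (c : ℂ) : Nice B 0 (fun _ _ => c)
  | rho (l : ℕ) : Nice B (-1) (fun ρ _ => (ρ l : ℂ))
  | rhoinv : Nice B 1 (fun ρ _ => (ρ 0 : ℂ)⁻¹)
  | zinv (i : ℕ) (hi : i < B) : Nice B 0 (fun _ z => (z i)⁻¹)
  | zzinv (i j : ℕ) (hi : i < B) (hj : j < B) (hij : i ≠ j) :
      Nice B 0 (fun _ z => (z i + z j)⁻¹)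
  | add {d : ℤ} {F G} (hF : Nice B d F) (hG : Nice B d G) :
      Nice B d (fun ρ z => F ρ z + G ρ z)
  | mul {d e : ℤ} {F G} (hF : Nice B d F) (hG : Nice B e G) :
      Nice B (d + e) (fun ρ z => F ρ z * G ρ z)

theorem Nice.cast {B : ℕ} {d e : ℤ} {F} (h : Nice B d F) (hde : d = e) : Nice B e F := hde ▸ h

theorem Nice.mono {B B' : ℕ} (hB : B ≤ B') {d : ℤ} {F} (h : Nice B d F) : Nice B' d F := by
  induction h with
  | zero d => exact .zero d
  | const c => exact .const c
  | rho l => exact .rho l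
  | rhoinv => exact .rhoinv
  | zinv i hi => exact .zinv i (by omega)
  | zzinv i j hi hj hij => exact .zzinv i j (by omega) (by omega) hij
  | add _ _ h1 h2 => exact .add h1 h2
  | mul _ _ h1 h2 => exact .mul h1 h2

theorem Dom.mono {B B' : ℕ} (hB : B ≤ B') {ρ z} (h : Dom B' ρ z) : Dom B ρ z :=
  ⟨h.1, fun i hi => h.2.1 i (by omega), fun i j hi hj => h.2.2 i j (by omega) (by omega)⟩

theorem Nice.drho {B : ℕ} {d : ℤ} {F} (h : Nice B d F) :
    ∃ (D : ℕ → (ℕ → ℝ) → (ℕ → ℂ) → ℂ) (M : ℕ), (∀ l, Nice B (d + 1) (D l)) ∧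
      (∀ l, M ≤ l → ∀ ρ z, D l ρ z = 0) ∧
      (∀ l ρ z, Dom B ρ z →
        HasDerivAt (fun t : ℝ => F (Function.update ρ l t) z) (D l ρ z) (ρ l)) ∧
      (∀ N ρ z, M ≤ N → Dom B ρ z →
        ∑ l ∈ Finset.range N, (ρ l : ℂ) * D l ρ z = -(d : ℂ) * F ρ z) := by
  induction h with
  | zero d =>
    exact ⟨fun _ _ _ => 0, 0, fun _ => .zero _, by simp, fun l ρ z _ => hasDerivAt_const _ _,
      by simp⟩
  | const c =>
    exact ⟨fun _ _ _ => 0, 0, fun _ => .zero _, by simp, fun l ρ z _ => hasDerivAt_const _ _,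
      by simp⟩
  | zinv i hi =>
    exact ⟨fun _ _ _ => 0, 0, fun _ => .zero _, by simp, fun l ρ z _ => hasDerivAt_const _ _,
      by simp⟩
  | zzinv i j hi hj hij =>
    exact ⟨fun _ _ _ => 0, 0, fun _ => .zero _, by simp, fun l ρ z _ => hasDerivAt_const _ _,
      by simp⟩
  | rho k =>
    refine ⟨fun l _ _ => if l = k then 1 else 0, k + 1, fun l => ?_, fun l hl ρ z => ?_,
      fun l ρ z _ => ?_, fun N ρ z hN _ => ?_⟩
    · by_cases hl : l = k
      · simp only [hl, if_true]; exact .const 1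
      · simp only [hl, if_false]; exact .zero _
    · exact if_neg (by omega)
    · by_cases hl : l = k
      · subst hl
        simp only [Function.update_self, if_true]
        simpa using (hasDerivAt_id (ρ l)).ofReal_comp
      · simp only [hl, if_false, Function.update_of_ne (Ne.symm hl)]
        exact hasDerivAt_const _ _
    · simp [Finset.sum_ite_eq', show k < N by omega]
  | rhoinv =>
    refine ⟨fun l ρ _ => if l = 0 then (-1) * ((ρ 0 : ℂ)⁻¹ * (ρ 0 : ℂ)⁻¹) else 0, 1, fun l => ?_,
      fun l hl ρ z => ?_, fun l ρ z h => ?_, fun N ρ z hN h => ?_⟩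
    · by_cases hl : l = 0
      · simp only [hl, if_true]
        exact ((Nice.const (-1)).mul (Nice.rhoinv.mul Nice.rhoinv)).cast (by norm_num)
      · simp only [hl, if_false]; exact .zero _
    · exact if_neg (by omega)
    · by_cases hl : l = 0
      · subst hl
        simp only [Function.update_self, if_true]
        have h0 : ((ρ 0 : ℝ) : ℂ) ≠ 0 := by exact_mod_cast h.1
        have := ((hasDerivAt_id (ρ 0)).ofReal_comp).fun_inv h0
        refine this.congr_deriv ?_
        simp [pow_two, div_eq_mul_inv]
      · simp only [hl, if_false, Function.update_of_ne (Ne.symm hl)]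
        exact hasDerivAt_const _ _
    · have h0 : ((ρ 0 : ℝ) : ℂ) ≠ 0 := by exact_mod_cast h.1
      simp only [mul_ite, mul_zero, Finset.sum_ite_eq', Finset.mem_range, show 0 < N by omega,
        if_true]
      push_cast; field_simp
  | @add d F G _ _ h1 h2 =>
    obtain ⟨D, M, a1, a2, a3, a4⟩ := h1
    obtain ⟨E, M', b1, b2, b3, b4⟩ := h2
    refine ⟨fun l ρ z => D l ρ z + E l ρ z, max M M', fun l => (a1 l).add (b1 l),
      fun l hl ρ z => ?_, fun l ρ z h => (a3 l ρ z h).add (b3 l ρ z h), fun N ρ z hN h => ?_⟩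
    · dsimp only
      rw [a2 l (le_trans (le_max_left _ _) hl), b2 l (le_trans (le_max_right _ _) hl), add_zero]
    · simp only [mul_add, Finset.sum_add_distrib]
      rw [a4 N ρ z (le_trans (le_max_left _ _) hN) h, b4 N ρ z (le_trans (le_max_right _ _) hN) h]
  | @mul d e F G hF hG h1 h2 =>
    obtain ⟨D, M, a1, a2, a3, a4⟩ := h1
    obtain ⟨E, M', b1, b2, b3, b4⟩ := h2
    refine ⟨fun l ρ z => D l ρ z * G ρ z + F ρ z * E l ρ z, max M M',
      fun l => (((a1 l).mul hG).cast (by ring)).add ((hF.mul (b1 l)).cast (by ring)),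
      fun l hl ρ z => ?_, fun l ρ z h => ?_, fun N ρ z hN h => ?_⟩
    · dsimp only
      rw [a2 l (le_trans (le_max_left _ _) hl), b2 l (le_trans (le_max_right _ _) hl)]; simp
    · simpa using (a3 l ρ z h).fun_mul (b3 l ρ z h)
    · have e1 := a4 N ρ z (le_trans (le_max_left _ _) hN) h
      have e2 := b4 N ρ z (le_trans (le_max_right _ _) hN) h
      have : ∑ l ∈ Finset.range N, (ρ l : ℂ) * (D l ρ z * G ρ z + F ρ z * E l ρ z)
          = (∑ l ∈ Finset.range N, (ρ l : ℂ) * D l ρ z) * G ρ z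
            + F ρ z * ∑ l ∈ Finset.range N, (ρ l : ℂ) * E l ρ z := by
        rw [Finset.sum_mul, Finset.mul_sum, ← Finset.sum_add_distrib]
        exact Finset.sum_congr rfl fun _ _ => by ring
      rw [this, e1, e2]; push_cast; ring

theorem hasDerivAt_coord (z : ℕ → ℂ) (i k : ℕ) :
    HasDerivAt (fun v : ℂ => Function.update z k v i) (if i = k then 1 else 0) (z k) := by
  by_cases h : i = k
  · subst h
    simpa using hasDerivAt_id' (z i)
  · simp only [h, if_false, Function.update_of_ne h]
    exact hasDerivAt_const _ _

theorem Nice.dz {B : ℕ} {d : ℤ} {F} (h : Nice B d F) (k : ℕ) :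
    ∃ F', Nice B d F' ∧ ∀ ρ z, Dom B ρ z →
      HasDerivAt (fun v : ℂ => F ρ (Function.update z k v)) (F' ρ z) (z k) := by
  induction h with
  | zero d => exact ⟨fun _ _ => 0, .zero _, fun _ _ _ => hasDerivAt_const _ _⟩
  | const c => exact ⟨fun _ _ => 0, .zero _, fun _ _ _ => hasDerivAt_const _ _⟩
  | rho l => exact ⟨fun _ _ => 0, .zero _, fun _ _ _ => hasDerivAt_const _ _⟩
  | rhoinv => exact ⟨fun _ _ => 0, .zero _, fun _ _ _ => hasDerivAt_const _ _⟩
  | zinv i hi =>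
    refine ⟨fun _ z => (-(if i = k then 1 else 0)) * ((z i)⁻¹ * (z i)⁻¹),
      ((Nice.const _).mul ((Nice.zinv i hi).mul (Nice.zinv i hi))).cast (by norm_num),
      fun ρ z h => ?_⟩
    have h0 := h.2.1 i hi
    have := (hasDerivAt_coord z i k).fun_inv (by simpa using h0)
    refine this.congr_deriv ?_
    simp [pow_two, div_eq_mul_inv]
  | zzinv i j hi hj hij =>
    refine ⟨fun _ z => (-((if i = k then 1 else 0) + (if j = k then 1 else 0))) *
        ((z i + z j)⁻¹ * (z i + z j)⁻¹),
      ((Nice.const _).mul ((Nice.zzinv i j hi hj hij).mul (Nice.zzinv i j hi hj hij))).cast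
        (by norm_num), fun ρ z h => ?_⟩
    have h0 := h.2.2 i j hi hj hij
    have := ((hasDerivAt_coord z i k).fun_add (hasDerivAt_coord z j k)).fun_inv (by simpa using h0)
    refine this.congr_deriv ?_
    simp [pow_two, div_eq_mul_inv]
  | add _ _ h1 h2 =>
    obtain ⟨F', a1, a2⟩ := h1
    obtain ⟨G', b1, b2⟩ := h2
    exact ⟨_, a1.add b1, fun ρ z h => (a2 ρ z h).fun_add (b2 ρ z h)⟩
  | @mul d e F G hF hG h1 h2 =>
    obtain ⟨F', a1, a2⟩ := h1
    obtain ⟨G', b1, b2⟩ := h2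
    refine ⟨_, (a1.mul hG).add (hF.mul b1), fun ρ z h => ?_⟩
    simpa using (a2 ρ z h).fun_mul (b2 ρ z h)

/-- Functions that agree with a `Nice` function on the domain. -/
def Good (B : ℕ) (d : ℤ) (F : (ℕ → ℝ) → (ℕ → ℂ) → ℂ) : Prop :=
  ∃ F', Nice B d F' ∧ ∀ ρ z, Dom B ρ z → F ρ z = F' ρ z

theorem Nice.good {B : ℕ} {d : ℤ} {F} (h : Nice B d F) : Good B d F := ⟨F, h, fun _ _ _ => rfl⟩

theorem Good.cast {B : ℕ} {d e : ℤ} {F} (h : Good B d F) (hde : d = e) : Good B e F := hde ▸ h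

theorem Good.congr {B : ℕ} {d : ℤ} {F G} (h : Good B d F)
    (hFG : ∀ ρ z, Dom B ρ z → G ρ z = F ρ z) : Good B d G := by
  obtain ⟨F', h1, h2⟩ := h
  exact ⟨F', h1, fun ρ z hd => (hFG ρ z hd).trans (h2 ρ z hd)⟩

theorem Good.mono {B B' : ℕ} (hB : B ≤ B') {d : ℤ} {F} (h : Good B d F) : Good B' d F := by
  obtain ⟨F', h1, h2⟩ := h
  exact ⟨F', h1.mono hB, fun ρ z hd => h2 ρ z (hd.mono hB)⟩

theorem Good.add {B : ℕ} {d : ℤ} {F G} (hF : Good B d F) (hG : Good B d G) :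
    Good B d (fun ρ z => F ρ z + G ρ z) := by
  obtain ⟨F', a1, a2⟩ := hF
  obtain ⟨G', b1, b2⟩ := hG
  exact ⟨_, a1.add b1, fun ρ z h => by simp only [a2 ρ z h, b2 ρ z h]⟩

theorem Good.mul {B : ℕ} {d e : ℤ} {F G} (hF : Good B d F) (hG : Good B e G) :
    Good B (d + e) (fun ρ z => F ρ z * G ρ z) := by
  obtain ⟨F', a1, a2⟩ := hF
  obtain ⟨G', b1, b2⟩ := hG
  exact ⟨_, a1.mul b1, fun ρ z h => by simp only [a2 ρ z h, b2 ρ z h]⟩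

theorem Good.cmul {B : ℕ} {d : ℤ} {F} (c : ℂ) (hF : Good B d F) :
    Good B d (fun ρ z => c * F ρ z) :=
  ((Nice.const c).good.mul hF).cast (by ring)

theorem Good.zero {B : ℕ} (d : ℤ) : Good B d (fun _ _ => 0) := (Nice.zero d).good

theorem Good.sum {B : ℕ} {d : ℤ} {ι : Type*} (s : Finset ι) {F : ι → (ℕ → ℝ) → (ℕ → ℂ) → ℂ}
    (h : ∀ i ∈ s, Good B d (F i)) : Good B d (fun ρ z => ∑ i ∈ s, F i ρ z) := by
  classical
  induction s using Finset.induction_on with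
  | empty => simpa using Good.zero d
  | insert a s ha ih =>
    simp only [Finset.sum_insert ha]
    exact (h a (by simp)).add (ih fun i hi => h i (by simp [hi]))

theorem Good.prod {B : ℕ} {ι : Type*} (s : Finset ι) {F : ι → (ℕ → ℝ) → (ℕ → ℂ) → ℂ}
    {d : ι → ℤ} (h : ∀ i ∈ s, Good B (d i) (F i)) :
    Good B (∑ i ∈ s, d i) (fun ρ z => ∏ i ∈ s, F i ρ z) := by
  classical
  induction s using Finset.induction_on with
  | empty => simpa using (Nice.const 1).good
  | insert a s ha ih =>
    simp only [Finset.prod_insert ha, Finset.sum_insert ha]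
    exact (h a (by simp)).mul (ih fun i hi => h i (by simp [hi]))

theorem Good.pow {B : ℕ} {d : ℤ} {F} (h : Good B d F) (n : ℕ) :
    Good B (n * d) (fun ρ z => F ρ z ^ n) := by
  have := Good.prod (Finset.range n) (fun i _ => h)
  simpa using this

theorem Good.ite {B : ℕ} {d : ℤ} {F} (p : Prop) [Decidable p] (h : p → Good B d F) :
    Good B d (fun ρ z => if p then F ρ z else 0) := by
  by_cases hp : p
  · simpa only [hp, if_true] using h hp
  · simpa only [hp, if_false] using Good.zero d

theorem Dom.updρ {B : ℕ} {ρ z} (h : Dom B ρ z) (l : ℕ) :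
    ∀ᶠ t in nhds (ρ l), Dom B (Function.update ρ l t) z := by
  have : ∀ᶠ t in nhds (ρ l), Function.update ρ l t 0 ≠ 0 := by
    by_cases hl : l = 0
    · subst hl
      simpa using eventually_ne_nhds h.1
    · simp [Function.update_of_ne (Ne.symm hl), h.1]
  filter_upwards [this] with t ht
  exact ⟨ht, h.2⟩

theorem Dom.updz {B : ℕ} {ρ z} (h : Dom B ρ z) (k : ℕ) :
    ∀ᶠ v in nhds (z k), Dom B ρ (Function.update z k v) := by
  have c : ∀ i, ContinuousAt (fun v : ℂ => Function.update z k v i) (z k) :=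
    fun i => (hasDerivAt_coord z i k).continuousAt
  have h1 : ∀ᶠ v in nhds (z k), ∀ i ∈ Finset.range B, Function.update z k v i ≠ 0 := by
    rw [Filter.eventually_all_finset]
    intro i hi
    apply (c i).eventually_ne
    simpa using h.2.1 i (Finset.mem_range.1 hi)
  have h2 : ∀ᶠ v in nhds (z k), ∀ i ∈ Finset.range B, ∀ j ∈ Finset.range B, i ≠ j →
      Function.update z k v i + Function.update z k v j ≠ 0 := by
    rw [Filter.eventually_all_finset]
    intro i hi
    rw [Filter.eventually_all_finset]
    intro j hj
    by_cases hij : i = j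
    · simp [hij]
    have := ((c i).add (c j)).eventually_ne (y := 0)
      (by simpa using h.2.2 i j (Finset.mem_range.1 hi) (Finset.mem_range.1 hj) hij)
    filter_upwards [this] with v hv _ using hv
  filter_upwards [h1, h2] with v a b
  exact ⟨h.1, fun i hi => a i (by simpa), fun i j hi hj => b i (by simpa) j (by simpa)⟩

theorem Good.drho {B : ℕ} {d : ℤ} {F} (h : Good B d F) :
    ∃ M : ℕ, (∀ l, Good B (d + 1) (fun ρ z => pdC (fun σ => F σ z) l ρ)) ∧
      (∀ l, M ≤ l → ∀ ρ z, Dom B ρ z → pdC (fun σ => F σ z) l ρ = 0) ∧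
      (∀ ρ z, Dom B ρ z →
        ∑ l ∈ Finset.range M, (ρ l : ℂ) * pdC (fun σ => F σ z) l ρ = -(d : ℂ) * F ρ z) := by
  obtain ⟨F', h1, h2⟩ := h
  obtain ⟨D, M, a1, a2, a3, a4⟩ := h1.drho
  have key : ∀ l ρ z, Dom B ρ z → pdC (fun σ => F σ z) l ρ = D l ρ z := by
    intro l ρ z hd
    have := (a3 l ρ z hd).congr_of_eventuallyEq (f₁ := fun t : ℝ => F (Function.update ρ l t) z)
      (by filter_upwards [hd.updρ l] with t ht using h2 _ _ ht)
    exact this.deriv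
  refine ⟨M, fun l => ⟨D l, a1 l, key l⟩, fun l hl ρ z hd => ?_, fun ρ z hd => ?_⟩
  · rw [key l ρ z hd, a2 l hl]
  · rw [h2 ρ z hd, ← a4 M ρ z le_rfl hd]
    exact Finset.sum_congr rfl fun l _ => by rw [key l ρ z hd]

theorem Good.dz {B : ℕ} {d : ℤ} {F} (h : Good B d F) (k : ℕ) :
    Good B d (fun ρ z => deriv (fun v => F ρ (Function.update z k v)) (z k)) := by
  obtain ⟨F', h1, h2⟩ := h
  obtain ⟨D, a1, a2⟩ := h1.dz k
  refine ⟨D, a1, fun ρ z hd => ?_⟩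
  have := (a2 ρ z hd).congr_of_eventuallyEq (f₁ := fun v => F ρ (Function.update z k v))
      (by filter_upwards [hd.updz k] with t ht using h2 _ _ ht)
  exact this.deriv

theorem Good.tsum {B : ℕ} {d : ℤ} {F : ℕ → (ℕ → ℝ) → (ℕ → ℂ) → ℂ} (M : ℕ)
    (h : ∀ l, Good B d (F l)) (h0 : ∀ l, M ≤ l → ∀ ρ z, Dom B ρ z → F l ρ z = 0) :
    Good B d (fun ρ z => ∑' l, F l ρ z) := by
  refine (Good.sum (Finset.range M) (fun l _ => h l)).congr fun ρ z hd => ?_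
  exact tsum_eq_sum fun l hl => h0 l (by simpa using hl) ρ z hd

theorem Good.euler {B : ℕ} {d : ℤ} {F} (h : Good B d F) {ρ z} (hd : Dom B ρ z) :
    -∑' l : ℕ, (ρ l : ℂ) * pdC (fun σ => F σ z) l ρ = (d : ℂ) * F ρ z := by
  obtain ⟨M, _, a2, a3⟩ := h.drho
  rw [tsum_eq_sum (s := Finset.range M), a3 ρ z hd]
  · ring
  · intro l hl
    rw [a2 l (by simpa using hl) ρ z hd, mul_zero]

theorem Good.tsum_pd {B : ℕ} {d e : ℤ} {F} {a : ℕ → (ℕ → ℝ) → (ℕ → ℂ) → ℂ} (h : Good B d F)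
    (ha : ∀ l, Good B e (a l)) :
    Good B (d + 1 + e) (fun ρ z => ∑' l, a l ρ z * pdC (fun σ => F σ z) l ρ) := by
  obtain ⟨M, a1, a2, _⟩ := h.drho
  refine Good.tsum M (fun l => ((ha l).mul (a1 l)).cast (by ring)) fun l hl ρ z hd => ?_
  rw [a2 l hl ρ z hd, mul_zero]

theorem good_zinv {B i : ℕ} (hi : i < B) (n : ℕ) : Good B 0 (fun _ z => (z i ^ n)⁻¹) := by
  have := (Nice.zinv i hi).good.pow n
  simpa using this

theorem good_adag {n : ℕ} {d : ℤ} {F} (h : Good n d F) :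
    Good (n + 1) (d + 1) (AdagVar (Finset.range n) n F) := by
  have h' : Good (n + 1) d F := h.mono (by omega)
  have hn : n < n + 1 := by omega
  unfold AdagVar AdagFree
  refine Good.add ?_ (Good.sum _ fun i hi => ?_)
  · refine (h'.tsum_pd (e := 0) fun l => Good.add ?_ ?_).cast (by ring)
    · refine ((((Nice.rho (l + 1)).good.mul (Nice.rhoinv.good.mul (good_zinv hn 3))).cmul
        (-(3 + 2 * (l : ℂ)))).cast (by norm_num)).congr fun ρ z _ => ?_
      simp only [div_eq_mul_inv, mul_inv]; ring
    · exact ((good_zinv hn (5 + 2 * l)).cmul (3 + 2 * (l : ℂ))).congr fun ρ z _ => by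
        simp only [div_eq_mul_inv]
  · have hi' : i < n + 1 := by have := Finset.mem_range.1 hi; omega
    refine (((Nice.rhoinv.good.mul (good_zinv hn 3)).mul (good_zinv hi' 1)).mul
      (h'.dz i)).cast (by ring) |>.congr fun ρ z _ => ?_
    simp only [div_eq_mul_inv, mul_inv, pow_one]; ring

/-! Scalars. -/

/-- Scalar version. -/
abbrev GoodS (d : ℤ) (c : (ℕ → ℝ) → ℝ) : Prop := Good 0 d (fun ρ _ => (c ρ : ℂ))

theorem dom0 {ρ : ℕ → ℝ} (h : ρ 0 ≠ 0) (z : ℕ → ℂ) : Dom 0 ρ z :=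
  ⟨h, fun i hi => by omega, fun i j hi => by omega⟩

theorem pdC_ofReal (c : (ℕ → ℝ) → ℝ) (l : ℕ) (ρ : ℕ → ℝ) :
    pdC (fun σ => (c σ : ℂ)) l ρ = (pdR c l ρ : ℂ) := by
  unfold pdC pdR
  by_cases h : DifferentiableAt ℝ (fun t => c (Function.update ρ l t)) (ρ l)
  · exact (h.hasDerivAt.ofReal_comp).deriv
  · rw [deriv_zero_of_not_differentiableAt h, deriv_zero_of_not_differentiableAt]
    · simp
    · intro h2
      apply h
      have := Complex.reCLM.differentiableAt.comp (ρ l) h2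
      exact this

theorem GoodS.pd {d : ℤ} {c} (h : GoodS d c) :
    ∃ M : ℕ, (∀ l, GoodS (d + 1) (pdR c l)) ∧
      (∀ l, M ≤ l → ∀ ρ : ℕ → ℝ, ρ 0 ≠ 0 → pdR c l ρ = 0) := by
  obtain ⟨M, a1, a2, _⟩ := h.drho
  simp only [pdC_ofReal] at a1 a2
  exact ⟨M, a1, fun l hl ρ hρ => by simpa using a2 l hl ρ 0 (dom0 hρ 0)⟩

theorem pdR_zero {c : (ℕ → ℝ) → ℝ} (h : ∀ ρ : ℕ → ℝ, ρ 0 ≠ 0 → c ρ = 0) (l : ℕ)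
    (ρ : ℕ → ℝ) (hρ : ρ 0 ≠ 0) : pdR c l ρ = 0 := by
  unfold pdR
  have : (fun t => c (Function.update ρ l t)) =ᶠ[nhds (ρ l)] fun _ => 0 := by
    filter_upwards [(dom0 hρ 0).updρ l] with t ht using h _ ht.1
  rw [this.deriv_eq]; simp

theorem GoodS.ite {d : ℤ} {c : (ℕ → ℝ) → ℝ} (p : Prop) [Decidable p] (h : p → GoodS d c) :
    Good 0 d (fun ρ _ => ((if p then c ρ else 0 : ℝ) : ℂ)) := by
  by_cases hp : p
  · simpa only [hp, if_true] using h hp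
  · simpa only [hp, if_false, Complex.ofReal_zero] using Good.zero d

theorem goodS_Sm (m : ℕ) : GoodS 0 (fun ρ => Sm ρ m) := by
  unfold GoodS Sm bellP
  push_cast
  refine Good.sum _ fun i hi => ?_
  have h1 : Good 0 (i : ℤ) (fun ρ _ => (-1) ^ i * (i.factorial : ℂ) * ((ρ 0 : ℂ)⁻¹) ^ i) :=
    ((Nice.rhoinv.good.pow i).cmul _).cast (by ring)
  refine (h1.mul (e := -(i : ℤ)) (Good.sum _ fun j _ => ?_)).cast (by ring)
  refine GoodS.ite _ fun hc => ?_
  unfold GoodS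
  push_cast
  refine Good.cmul _ ((Good.prod _ fun k _ => Good.pow (d := -1) ?_ _).cast (?_))
  · refine ((Nice.rho (k + 1)).good.cmul
      (((k : ℕ) + 1).factorial / ((k : ℕ) + 1).factorial : ℂ)).congr fun ρ z _ => ?_
    ring
  · rw [← hc.1]; push_cast; simp

theorem goodS_eBr (lam : ℝ) (g : ℕ) (hg : 2 ≤ g) (prev : ℕ → ℕ → (ℕ → ℝ) → ℝ)
    (h : ∀ h k : ℕ, GoodS (2 * (h : ℤ) - 1) (prev h k)) (m : ℕ) :
    GoodS (2 * g - 2) (eBr lam g prev m) := by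
  unfold GoodS eBr
  push_cast
  have hg' : ((g - 1 : ℕ) : ℤ) = g - 1 := by omega
  refine Good.add (Good.sum _ fun h' hh => Good.sum _ fun i _ => Good.sum _ fun j _ => ?_)
    (Good.cmul _ (Good.add (Good.add ?_ (Good.sum _ fun i _ => Good.sum _ fun j _ => ?_)) ?_))
  · refine GoodS.ite _ fun _ => ?_
    unfold GoodS
    push_cast
    refine ((h h' i).mul (h (g - h') j)).cast ?_
    have := Finset.mem_Icc.1 hh
    omega
  · refine GoodS.ite _ fun _ => ?_
    unfold GoodS
    push_cast
    have := (h (g - 1) (m - 2)).tsum_pd (e := -1)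
      (a := fun l ρ _ => (3 + 2 * (l : ℂ)) * (ρ (l + 1) : ℂ))
      (fun l => (Nice.rho (l + 1)).good.cmul _)
    refine (((Nice.rhoinv.good.mul this).cmul (-1)).cast ?_).congr fun ρ z _ => ?_
    · rw [hg']; ring
    · simp only [pdC_ofReal]; push_cast; ring
  · obtain ⟨M, a, -⟩ := GoodS.pd (h (g - 1) i)
    refine GoodS.ite _ fun _ => ?_
    unfold GoodS
    push_cast
    refine ((a j).cmul _).cast ?_
    rw [hg']; ring
  · refine GoodS.ite _ fun _ => ?_
    unfold GoodS
    push_cast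
    refine (((Nice.rhoinv.good.mul (h (g - 1) (m - 3))).cmul
      (-(2 * ((m - 3 : ℕ) : ℂ) + 3))).cast ?_).congr fun ρ z _ => ?_
    · rw [hg']; ring
    · simp only [div_eq_mul_inv]; push_cast; ring

theorem eBr_zero (lam : ℝ) (g : ℕ) (prev : ℕ → ℕ → (ℕ → ℝ) → ℝ)
    (h : ∀ h k : ℕ, GoodS (2 * (h : ℤ) - 1) (prev h k)) (K : ℕ)
    (hK : ∀ h k, K ≤ k → ∀ ρ : ℕ → ℝ, ρ 0 ≠ 0 → prev h k ρ = 0) :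
    ∃ K', ∀ m, K' ≤ m → ∀ ρ : ℕ → ℝ, ρ 0 ≠ 0 → eBr lam g prev m ρ = 0 := by
  choose M _ hM using fun k => GoodS.pd (h (g - 1) k)
  refine ⟨2 * K + (Finset.range K).sup M + 3, fun m hm ρ hρ => ?_⟩
  have hpd : ∀ k l, K ≤ k → pdR (prev (g - 1) k) l ρ = 0 := fun k l hk =>
    pdR_zero (hK _ k hk) l ρ hρ
  unfold eBr
  have s1 : (∑ h ∈ Finset.Icc 1 (g - 1), ∑ i ∈ Finset.range (m + 1), ∑ j ∈ Finset.range (m + 1),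
      if i + j + 2 = m then prev h i ρ * prev (g - h) j ρ else 0) = 0 := by
    refine Finset.sum_eq_zero fun h' _ => Finset.sum_eq_zero fun i _ =>
      Finset.sum_eq_zero fun j _ => ?_
    split_ifs with hij
    · by_cases hi : K ≤ i
      · rw [hK h' i hi ρ hρ, zero_mul]
      · rw [hK (g - h') j (by omega) ρ hρ, mul_zero]
    · rfl
  have s2 : (∑ k ∈ Finset.range (m + 1), ∑ l ∈ Finset.range (m + 1),
        if k + l + 3 = m then (3 + 2 * (l : ℝ)) * pdR (prev (g - 1) k) l ρ else 0) = 0 := by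
    refine Finset.sum_eq_zero fun i _ => Finset.sum_eq_zero fun j _ => ?_
    split_ifs with hij
    · by_cases hi : K ≤ i
      · rw [hpd i j hi, mul_zero]
      · have : M i ≤ (Finset.range K).sup M := Finset.le_sup (by simpa using hi)
        rw [hM i j (by omega) ρ hρ, mul_zero]
    · rfl
  rw [s1, s2, hK (g - 1) (m - 3) (by omega) ρ hρ]
  simp [hpd (m - 2) _ (show K ≤ m - 2 by omega)]

theorem Gtab_good (lam : ℝ) (G : ℕ) : (∀ h k : ℕ, GoodS (2 * (h : ℤ) - 1) (Gtab lam G h k)) ∧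
    ∃ K, ∀ h k, K ≤ k → ∀ ρ : ℕ → ℝ, ρ 0 ≠ 0 → Gtab lam G h k ρ = 0 := by
  induction G with
  | zero =>
    simp only [Gtab]
    exact ⟨fun h k => by simpa [GoodS] using Good.zero _, 0, by simp⟩
  | succ G ih =>
    rcases G with _ | G
    · simp only [zero_add, Gtab]
      refine ⟨fun h k => ?_, 2, fun h k hk ρ _ => ?_⟩
      · unfold GoodS
        by_cases hh : h = 1
        · subst hh
          simp only [if_true]
          by_cases hk : k = 0
          · simp only [hk, if_true]
            refine ((((Nice.rho 1).good.mul (Nice.rhoinv.good.mul Nice.rhoinv.good)).cmul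
              (2 * (lam : ℂ) ^ 4)).cast (by norm_num)).congr fun ρ z _ => ?_
            push_cast
            simp only [div_eq_mul_inv, inv_pow]; ring
          · simp only [hk, if_false]
            by_cases hk : k = 1
            · simp only [hk, if_true]
              refine ((Nice.rhoinv.good.cmul (-(2 * (lam : ℂ) ^ 4))).cast (by norm_num)).congr
                fun ρ z _ => ?_
              push_cast
              simp only [div_eq_mul_inv]
            · simp only [hk, if_false, Complex.ofReal_zero]
              exact Good.zero _
        · simp only [hh, if_false, Complex.ofReal_zero]
          exact Good.zero _
      · rw [if_neg (show k ≠ 0 by omega), if_neg (show k ≠ 1 by omega)]; simp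
    · obtain ⟨h1, K, hK⟩ := ih
      obtain ⟨K', hK'⟩ := eBr_zero lam (G + 2) _ h1 K hK
      have hE := goodS_eBr lam (G + 2) (by omega) _ h1
      simp only [Gtab]
      refine ⟨fun h k => ?_, max K K', fun h k hk ρ hρ => ?_⟩
      · unfold GoodS
        by_cases hh : h ≤ G + 1
        · simp only [hh, if_true]; exact h1 h k
        · simp only [hh, if_false]
          by_cases hh : h = G + 2
          · subst hh
            simp only [if_true]
            push_cast
            have : Good 0 (2 * (G + 2 : ℕ) - 2) (fun ρ _ => ∑' j : ℕ,
                (eBr lam (G + 2) (Gtab lam (G + 1)) (k + j) ρ : ℂ) * (Sm ρ j : ℂ)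
                  / (j.factorial : ℂ)) := by
              refine Good.tsum K' (fun j => ?_) fun j hj ρ z hd => ?_
              · exact ((((hE (k + j)).mul (goodS_Sm j)).cmul
                  ((j.factorial : ℂ)⁻¹)).cast (by ring)).congr fun ρ z _ => by
                    simp only [div_eq_mul_inv]; ring
              · rw [hK' (k + j) (by omega) ρ hd.1]; simp
            refine (((Nice.rhoinv.good.mul this).cmul (-(1 / 2))).cast ?_).congr fun ρ z _ => ?_
            · push_cast; ring
            · simp only [one_div, mul_inv]; ring
          · simp only [hh, if_false, Complex.ofReal_zero]
            exact Good.zero _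
      · split_ifs
        · exact hK h k (le_trans (le_max_left _ _) hk) ρ hρ
        · have : K' ≤ k := le_trans (le_max_right _ _) hk
          have e : ∀ j, eBr lam (G + 2) (Gtab lam (G + 1)) (k + j) ρ = 0 := fun j =>
            hK' (k + j) (by omega) ρ hρ
          simp [e]
        · rfl

theorem good_Gfun (lam : ℝ) (g : ℕ) : Good 1 (2 * g - 1) (fun ρ z => Gfun lam g ρ (z 0)) := by
  obtain ⟨h1, K, hK⟩ := Gtab_good lam g
  unfold Gfun Gcoef
  refine Good.tsum K (fun k => ?_) fun k hk ρ z hd => ?_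
  · exact ((((h1 g k).mono (Nat.zero_le 1)).mul
      (good_zinv (show 0 < 1 by omega) (2 * k + 3))).cast (by ring)).congr fun ρ z _ => by
        simp only [div_eq_mul_inv]
  · rw [hK g k hk ρ hd.1]; simp

theorem good_GBraw (lam : ℝ) (g n : ℕ) : Good (n + 1) (2 * g - 1 + n) (GBraw lam g (n + 1)) := by
  induction n with
  | zero => simpa [GBraw] using good_Gfun lam g
  | succ n ih =>
    simp only [GBraw]
    exact (good_adag ih).cast (by push_cast; ring)

theorem good_GBraw0 (lam : ℝ) (n : ℕ) : Good (n + 2) n (GBraw0 lam (n + 2)) := by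
  induction n with
  | zero =>
    simp only [zero_add, GBraw0]
    refine ((((good_zinv (show 0 < 2 by omega) 1).mul (good_zinv (show 1 < 2 by omega) 1)).mul
      ((Nice.zzinv 0 1 (show 0 < 2 by omega) (show 1 < 2 by omega) (by omega)).good.pow 2)).cmul
      (4 * (lam : ℂ) ^ 2)).cast (by norm_num) |>.congr fun ρ z _ => ?_
    simp only [div_eq_mul_inv, mul_inv, pow_one, inv_pow]
  | succ n ih =>
    simp only [GBraw0]
    exact (good_adag ih).cast (by push_cast; ring)

theorem good_GBfun (lam : ℝ) (g B : ℕ) (hB : 1 ≤ B) (hgB : 2 < 2 * g + B) :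
    Good B ((2 * g + B - 2 : ℕ) : ℤ) (GBfun lam g B) := by
  unfold GBfun
  by_cases hg : g = 0
  · subst hg
    obtain ⟨n, rfl⟩ : ∃ n, B = n + 2 := ⟨B - 2, by omega⟩
    simp only [if_true]
    exact ((good_GBraw0 lam n).cmul _).cast (by omega)
  · obtain ⟨n, rfl⟩ : ∃ n, B = n + 1 := ⟨B - 1, by omega⟩
    simp only [hg, if_false]
    by_cases hB1 : n + 1 = 1
    · simp only [hB1, if_true]
      exact (good_Gfun lam g).cast (by omega)
    · simp only [hB1, if_false]
      exact ((good_GBraw lam g n).cmul _).cast (by omega)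

end NCQFT

open NCQFT in
/-- `N̂` measures the Euler characteristic:
`N̂ 𝒢_g(z₁|…|z_B) = (2g+B−2) 𝒢_g(z₁|…|z_B)` whenever `2g+B−2 > 0`. -/
theorem stmt11 (lam : ℝ) (hlam : lam ≠ 0) (g B : ℕ) (hB : 1 ≤ B) (hgB : 2 < 2 * g + B)
    (ρ : ℕ → ℝ) (hρ0 : ρ 0 ≠ 0) (z : ℕ → ℂ)
    (hz : ∀ i, i < B → z i ≠ 0)
    (hzz : ∀ i j, i < B → j < B → i ≠ j → z i + z j ≠ 0) :
    (-∑' l : ℕ, (ρ l : ℂ) * pdC (fun σ => GBfun lam g B σ z) l ρ)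
      = ((2 * g + B - 2 : ℕ) : ℂ) * GBfun lam g B ρ z := by
  exact_mod_cast (good_GBfun lam g B hB hgB).euler ⟨hρ0, hz, hzz⟩
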